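/- (Basin of attraction inclusion.) Let h_t be a terminal control law for terminal set 𝒳_t and let N^c ≤ N^a. If x_0 admits a feasible solution of the complex OCP P(x_0) with horizon N^c, then x_0 lies in the adaptive feasibility region X_{N^a}: there exist an admissible simplicity set S and a feasible adaptive trajectory for the adaptive OCP P^a(x_0) with horizon N^a. Consequently X^cplx_{N^c} ⊆ X_{N^a}, where X^cplx_{N^c} is the set of states admitting a feasible complex OCP solution with horizon N^c. -/

import Mathlib

/-- Abstract adaptive-complexity MPC framework: complex system, simple system,
reduction `red` (ψ) with state component `redx` (ψ_x), lift `lift` (ψ†) with state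
component `liftx` (ψ†_x), satisfying ψ ∘ ψ† = id. -/
structure ACSys (Xc Uc Xs Us : Type*) where
  fc : Xc × Uc → Xc
  fs : Xs × Us → Xs
  Zc : Set (Xc × Uc)
  Zs : Set (Xs × Us)
  red : Xc × Uc → Xs × Us
  redx : Xc → Xs
  lift : Xs × Us → Xc × Uc
  liftx : Xs → Xc
  redx_spec : ∀ z : Xc × Uc, (red z).1 = redx z.1
  liftx_spec : ∀ z : Xs × Us, (lift z).1 = liftx z.1
  red_lift : ∀ z : Xs × Us, red (lift z) = z

/-- An adaptive trajectory: complex-space data `(xC i, uC i)` used when `i ∉ S`,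
simple-space data `(xS i, uS i)` used when `i ∈ S`. -/
structure ACTraj (Xc Uc Xs Us : Type*) where
  xC : ℕ → Xc
  uC : ℕ → Uc
  xS : ℕ → Xs
  uS : ℕ → Us

variable {Xc Uc Xs Us : Type*}

/-- The lifted state-control pair `z^l_i`. -/
def zl (A : ACSys Xc Uc Xs Us) (S : Finset ℕ) (T : ACTraj Xc Uc Xs Us) (i : ℕ) : Xc × Uc :=
  if i ∈ S then A.lift (T.xS i, T.uS i) else (T.xC i, T.uC i)

/-- The lifted state `x^l_i`. -/
def xl (A : ACSys Xc Uc Xs Us) (S : Finset ℕ) (T : ACTraj Xc Uc Xs Us) (i : ℕ) : Xc :=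
  if i ∈ S then A.liftx (T.xS i) else T.xC i

/-- The lifted control sequence `u^l`. -/
def ul (A : ACSys Xc Uc Xs Us) (S : Finset ℕ) (T : ACTraj Xc Uc Xs Us) : ℕ → Uc :=
  fun i => (zl A S T i).2

/-- The adaptive dynamics: the four cases according to membership of `i`, `i+1` in `S`. -/
def AdaptDyn (A : ACSys Xc Uc Xs Us) (N : ℕ) (S : Finset ℕ) (T : ACTraj Xc Uc Xs Us) : Prop :=
  ∀ i, i < N →
    (i ∉ S → i + 1 ∉ S → T.xC (i + 1) = A.fc (T.xC i, T.uC i)) ∧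
    (i ∉ S → i + 1 ∈ S → T.xS (i + 1) = A.redx (A.fc (T.xC i, T.uC i))) ∧
    (i ∈ S → i + 1 ∉ S → T.xC (i + 1) = A.fc (A.lift (T.xS i, T.uS i))) ∧
    (i ∈ S → i + 1 ∈ S → T.xS (i + 1) = A.fs (T.xS i, T.uS i))

/-- Admissibility of the simplicity set `S` for an adaptive trajectory:
for each `i ∈ S`, (i) `1 ≤ i ≤ N-1`; (ii) `ψ†(ψ(z^l_i)) ∈ 𝒵^c`;
(iii) `ψ†_x(f^s(ψ(z^l_i))) = f^c(z^l_i)`; (iv) `ψ†_x(ψ_x(f^c(z^l_{i-1}))) = f^c(z^l_{i-1})`. -/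
def AdmissibleSet (A : ACSys Xc Uc Xs Us) (N : ℕ) (S : Finset ℕ) (T : ACTraj Xc Uc Xs Us) : Prop :=
  ∀ i ∈ S,
    (1 ≤ i ∧ i < N) ∧
    A.lift (A.red (zl A S T i)) ∈ A.Zc ∧
    A.liftx (A.fs (A.red (zl A S T i))) = A.fc (zl A S T i) ∧
    A.liftx (A.redx (A.fc (zl A S T (i - 1)))) = A.fc (zl A S T (i - 1))

/-- The solution map φ of the complex system: `φ 0 x u = x`, `φ (i+1) x u = f^c(φ i x u, u i)`. -/
def Phi (A : ACSys Xc Uc Xs Us) : ℕ → Xc → (ℕ → Uc) → Xc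
  | 0, x, _ => x
  | i + 1, x, u => A.fc (Phi A i x u, u i)

/-- Feasibility of an adaptive trajectory for the adaptive OCP `P^a(x)` with horizon `N`
and terminal set `Xt`. -/
def FeasAdapt (A : ACSys Xc Uc Xs Us) (N : ℕ) (S : Finset ℕ) (T : ACTraj Xc Uc Xs Us)
    (Xt : Set Xc) (x : Xc) : Prop :=
  T.xC 0 = x ∧ (∀ i ∈ S, (T.xS i, T.uS i) ∈ A.Zs) ∧
    (∀ i, i < N → i ∉ S → (T.xC i, T.uC i) ∈ A.Zc) ∧ T.xC N ∈ Xt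

/-- A terminal control law for terminal set `Xt`. -/
def TermLaw (A : ACSys Xc Uc Xs Us) (Xt : Set Xc) (ht : Xc → Uc) : Prop :=
  ∀ x ∈ Xt, (x, ht x) ∈ A.Zc ∧ A.fc (x, ht x) ∈ Xt

/-- Feasibility of a control sequence for the complex OCP `P(x)` with horizon `N`. -/
def FeasComplex (A : ACSys Xc Uc Xs Us) (N : ℕ) (Xt : Set Xc) (x : Xc) (u : ℕ → Uc) : Prop :=
  (∀ i, i < N → (Phi A i x u, u i) ∈ A.Zc) ∧ Phi A N x u ∈ Xt

/-- The adaptive feasibility region `X_N`. -/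
def XNreg (A : ACSys Xc Uc Xs Us) (N : ℕ) (Xt : Set Xc) : Set Xc :=
  {x | ∃ (S : Finset ℕ) (T : ACTraj Xc Uc Xs Us),
    AdmissibleSet A N S T ∧ AdaptDyn A N S T ∧ FeasAdapt A N S T Xt x}

/-- The set of states admitting a feasible complex OCP solution with horizon `N`. -/
def XcplxSet (A : ACSys Xc Uc Xs Us) (N : ℕ) (Xt : Set Xc) : Set Xc :=
  {x | ∃ u : ℕ → Uc, FeasComplex A N Xt x u}

/-- The cost of an adaptive trajectory: `Σ_{i<N} L^c(z^l_i) + V_t(x^l_N)`. -/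
noncomputable def trajCost (A : ACSys Xc Uc Xs Us) (N : ℕ) (S : Finset ℕ)
    (T : ACTraj Xc Uc Xs Us) (Lc : Xc × Uc → ℝ) (Vt : Xc → ℝ) : ℝ :=
  (∑ i ∈ Finset.range N, Lc (zl A S T i)) + Vt (xl A S T N)

/-- The optimal value `V*_N(x)`: infimum of costs over admissible simplicity sets and
feasible adaptive trajectories for `P^a(x)`. -/
noncomputable def Vstar (A : ACSys Xc Uc Xs Us) (N : ℕ) (Xt : Set Xc)
    (Lc : Xc × Uc → ℝ) (Vt : Xc → ℝ) (x : Xc) : ℝ :=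
  sInf {c | ∃ (S : Finset ℕ) (T : ACTraj Xc Uc Xs Us),
    AdmissibleSet A N S T ∧ AdaptDyn A N S T ∧ FeasAdapt A N S T Xt x ∧
    c = trajCost A N S T Lc Vt}

theorem Phi_congr_aux (A : ACSys Xc Uc Xs Us) (x : Xc) (u v : ℕ → Uc) :
    ∀ n, (∀ i, i < n → u i = v i) → Phi A n x u = Phi A n x v := by
  intro n
  induction n with
  | zero => intro _; rfl
  | succ k ih =>
    intro h
    simp only [Phi]
    rw [ih (fun i hi => h i (by omega)), h k (by omega)]

theorem FeasComplex_succ_aux (A : ACSys Xc Uc Xs Us) (N : ℕ) (Xt : Set Xc) (ht : Xc → Uc)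
    (hht : TermLaw A Xt ht) (x : Xc) (u : ℕ → Uc) (hu : FeasComplex A N Xt x u) :
    ∃ v, FeasComplex A (N + 1) Xt x v := by
  have hne : ∀ i, i < N → Function.update u N (ht (Phi A N x u)) i = u i := fun i hi =>
    Function.update_of_ne (by omega) _ _
  have hP : ∀ n, n ≤ N → Phi A n x (Function.update u N (ht (Phi A N x u))) = Phi A n x u :=
    fun n hn => Phi_congr_aux A x _ _ n (fun i hi => hne i (by omega))
  refine ⟨Function.update u N (ht (Phi A N x u)), ?_, ?_⟩
  · intro i hi
    rw [hP i (by omega)]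
    rcases Nat.lt_succ_iff_lt_or_eq.mp hi with h | h
    · rw [hne i h]
      exact hu.1 i h
    · subst h
      rw [Function.update_self]
      exact (hht _ hu.2).1
  · simp only [Phi]
    rw [hP N le_rfl, Function.update_self]
    exact (hht _ hu.2).2

theorem XcplxSet_subset_aux [Nonempty Xs] [Nonempty Us]
    (A : ACSys Xc Uc Xs Us) (Nc Na : ℕ) (hNN : Nc ≤ Na)
    (Xt : Set Xc) (ht : Xc → Uc) (hht : TermLaw A Xt ht) :
    XcplxSet A Nc Xt ⊆ XNreg A Na Xt := by
  rintro x hx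
  have hx' : ∃ v, FeasComplex A Na Xt x v := by
    induction Na, hNN using Nat.le_induction with
    | base => exact hx
    | succ n _ ih =>
      obtain ⟨v, hv⟩ := ih
      exact FeasComplex_succ_aux A n Xt ht hht x v hv
  obtain ⟨v, hv⟩ := hx'
  refine ⟨∅, ⟨fun i => Phi A i x v, v, fun _ => Classical.arbitrary Xs,
    fun _ => Classical.arbitrary Us⟩, ?_, ?_, rfl, ?_, fun i hi _ => hv.1 i hi, hv.2⟩
  · intro i hi
    simp at hi
  · intro i _
    simp [Phi]
  · intro i hi
    simp at hi

/-- basin of attraction inclusion: if `N^c ≤ N^a` and `x_0` admits a feasible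
complex OCP solution with horizon `N^c`, then `x_0` lies in the adaptive feasibility region
with horizon `N^a`; consequently `X^cplx_{N^c} ⊆ X_{N^a}`. -/
theorem basin_of_attraction_inclusion
    [Nonempty Xs] [Nonempty Us]
    (A : ACSys Xc Uc Xs Us) (Nc Na : ℕ) (hNN : Nc ≤ Na)
    (Xt : Set Xc) (ht : Xc → Uc) (hht : TermLaw A Xt ht)
    (x0 : Xc) (u : ℕ → Uc) (hu : FeasComplex A Nc Xt x0 u) :
    x0 ∈ XNreg A Na Xt ∧ XcplxSet A Nc Xt ⊆ XNreg A Na Xt := by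
  have h := XcplxSet_subset_aux A Nc Na hNN Xt ht hht
  exact ⟨h ⟨u, hu⟩, h⟩
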